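/- Let (κ_n)_{n≥1} be a sequence of reals and t, x ∈ ℝ. Define a_n := Y_n(tκ_1, tκ_2, …, tκ_n) for n ≥ 1 (with a_0 = 1), where Y_n is the complete exponential Bell polynomial; define q_0 = 1 and q_j = −Σ_{i=0}^{j−1} binom(j,i) q_i a_{j−i} for j ≥ 1, and Q_k(x) := Σ_{j=0}^k binom(k,j) q_j x^{k−j}. Then for every k ≥ 1: Q_k(x) = Y_k(x − tκ_1, −tκ_2, −tκ_3, …, −tκ_k). -/

import Mathlib

open scoped BigOperators

/-- The partial exponential Bell polynomial `B_{n,j}(x_1, …, x_{n-j+1})` over `ℝ`,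
evaluated on a sequence `x` (indexed from 1). -/
noncomputable def partialBell (n j : ℕ) (x : ℕ → ℝ) : ℝ :=
  ∑ f ∈ (Fintype.piFinset fun _ : Fin n => Finset.range (n + 1)) |>.filter
      (fun f => (∑ i, f i) = j ∧ (∑ i : Fin n, (i.1 + 1) * f i) = n),
    ((n.factorial : ℝ) /
        ∏ i : Fin n, (((f i).factorial : ℝ) * (((i.1 + 1).factorial : ℝ)) ^ (f i))) *
      ∏ i : Fin n, x (i.1 + 1) ^ f i

/-- The complete exponential Bell polynomial `Y_n(x_1, …, x_n)` over `ℝ`, with `Y_0 = 1`. -/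
noncomputable def completeBell (n : ℕ) (x : ℕ → ℝ) : ℝ :=
  ∑ j ∈ Finset.range (n + 1), partialBell n j x

open PowerSeries in
/-- The power series `exp (c X ^ (i + 1))`. -/
noncomputable def expMonomial (i : ℕ) (c : ℝ) : PowerSeries ℝ :=
  expand (i + 1) i.succ_ne_zero (rescale c (exp ℝ))

theorem expMonomial_add (i : ℕ) (c d : ℝ) :
    expMonomial i (c + d) = expMonomial i c * expMonomial i d := by
  simp only [expMonomial, ← map_mul, PowerSeries.exp_mul_exp_eq_exp_add]

theorem expMonomial_zero_right (i : ℕ) : expMonomial i 0 = 1 := by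
  simp [expMonomial]

theorem expMonomial_zero_left (c : ℝ) :
    expMonomial 0 c = PowerSeries.rescale c (PowerSeries.exp ℝ) := by
  simp [expMonomial]

theorem coeff_expMonomial_mul (i m : ℕ) (c : ℝ) :
    (expMonomial i c).coeff ((i + 1) * m) = c ^ m / m.factorial := by
  simp [expMonomial, PowerSeries.coeff_exp, div_eq_mul_inv]

theorem coeff_expMonomial_of_not_dvd {i m : ℕ} (c : ℝ) (h : ¬ i + 1 ∣ m) :
    (expMonomial i c).coeff m = 0 :=
  PowerSeries.coeff_expand_of_not_dvd _ _ _ h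

theorem coeff_mul_expMonomial {i k : ℕ} (h : k ≤ i) (c : ℝ) (P : PowerSeries ℝ) :
    (P * expMonomial i c).coeff k = P.coeff k := by
  rw [PowerSeries.coeff_mul, Finset.sum_eq_single (k, 0)]
  · have := coeff_expMonomial_mul i 0 c
    simp_all
  · rintro ⟨u, v⟩ huv hne
    rw [Finset.HasAntidiagonal.mem_antidiagonal] at huv
    have hv : v ≠ 0 := by
      rintro rfl
      exact hne (by simpa using huv)
    rw [coeff_expMonomial_of_not_dvd c fun hd => by
      have := Nat.le_of_dvd (Nat.pos_of_ne_zero hv) hd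
      simp only at huv
      omega, mul_zero]
  · simp

/-- The product of the series `exp (x_j X ^ j / j!)` for `1 ≤ j ≤ N`. -/
noncomputable def bellProd (N : ℕ) (x : ℕ → ℝ) : PowerSeries ℝ :=
  ∏ i ∈ Finset.range N, expMonomial i (x (i + 1) / (i + 1).factorial)

theorem coeff_bellProd_of_le {k N : ℕ} (h : k ≤ N) (x : ℕ → ℝ) :
    (bellProd N x).coeff k = (bellProd k x).coeff k := by
  induction N, h using Nat.le_induction with
  | base => rfl
  | succ N hN ih =>
    rw [bellProd, Finset.prod_range_succ, coeff_mul_expMonomial hN]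
    exact ih

theorem bellProd_add (N : ℕ) (x y : ℕ → ℝ) :
    bellProd N (fun i => x i + y i) = bellProd N x * bellProd N y := by
  simp only [bellProd, add_div, expMonomial_add, Finset.prod_mul_distrib]

theorem completeBell_eq_sum (n : ℕ) (x : ℕ → ℝ) :
    completeBell n x =
      ∑ f ∈ (Fintype.piFinset fun _ : Fin n => Finset.range (n + 1)) with
          ∑ i : Fin n, (i.1 + 1) * f i = n,
        ((n.factorial : ℝ) /
            ∏ i : Fin n, (((f i).factorial : ℝ) * (((i.1 + 1).factorial : ℝ)) ^ (f i))) *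
          ∏ i : Fin n, x (i.1 + 1) ^ f i := by
  unfold completeBell partialBell
  rw [← Finset.sum_fiberwise_of_maps_to (g := fun f : Fin n → ℕ => ∑ i, f i)
    (t := Finset.range (n + 1))]
  · simp only [Finset.filter_filter, and_comm]
  · intro f hf
    rw [Finset.mem_filter] at hf
    rw [Finset.mem_range, Nat.lt_succ_iff]
    exact (Finset.sum_le_sum fun i _ => Nat.le_mul_of_pos_left _ i.1.succ_pos).trans hf.2.le

theorem coeff_bellProd_self (n : ℕ) (x : ℕ → ℝ) :
    (bellProd n x).coeff n = completeBell n x / n.factorial := by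
  rw [completeBell_eq_sum, bellProd, Finset.prod_range, PowerSeries.coeff_prod, Finset.sum_div]
  symm
  apply Finset.sum_of_injOn
    (fun f : Fin n → ℕ => Finsupp.equivFunOnFinite.symm fun i => (i.1 + 1) * f i)
  · intro f _ g _ hfg
    funext i
    have := DFunLike.congr_fun hfg i
    simpa using this
  · intro f hf
    simpa using (Finset.mem_filter.1 hf).2
  · intro l hl hnot
    rw [Finset.mem_finsuppAntidiag] at hl
    by_cases hd : ∀ i : Fin n, i.1 + 1 ∣ l i
    · choose g hg using hd
      refine absurd ⟨g, ?_, ?_⟩ hnot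
      · simp only [Finset.coe_filter, Set.mem_ofPred_eq, Fintype.mem_piFinset, Finset.mem_range,
          Nat.lt_succ_iff]
        have hsum : ∑ i : Fin n, (i.1 + 1) * g i = n := by
          simpa only [← hg] using hl.1
        refine ⟨fun i => ?_, hsum⟩
        calc g i ≤ (i.1 + 1) * g i := Nat.le_mul_of_pos_left _ i.1.succ_pos
          _ ≤ ∑ i : Fin n, (i.1 + 1) * g i :=
            Finset.single_le_sum (f := fun i : Fin n => (i.1 + 1) * g i)
              (fun _ _ => Nat.zero_le _) (Finset.mem_univ i)
          _ = n := hsum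
      · ext i
        simp [hg i]
    · push Not at hd
      obtain ⟨i, hi⟩ := hd
      exact Finset.prod_eq_zero (Finset.mem_univ i) (coeff_expMonomial_of_not_dvd _ hi)
  · intro f _
    have hn : (n.factorial : ℝ) ≠ 0 := by positivity
    simp only [Finsupp.equivFunOnFinite_symm_apply_apply, coeff_expMonomial_mul, div_pow,
      Finset.prod_div_distrib, Finset.prod_mul_distrib]
    field_simp

/-- The exponential generating function of a sequence. -/
noncomputable def egf (f : ℕ → ℝ) : PowerSeries ℝ :=
  PowerSeries.mk fun n => f n / n.factorial

theorem egf_injective : Function.Injective egf := by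
  intro f g h
  funext n
  have hn : (n.factorial : ℝ) ≠ 0 := by positivity
  have := congrArg (PowerSeries.coeff n) h
  simpa [egf, div_left_inj' hn] using this

theorem egf_mul (f g : ℕ → ℝ) :
    egf f * egf g =
      egf fun n => ∑ i ∈ Finset.range (n + 1), (n.choose i : ℝ) * f i * g (n - i) := by
  ext n
  simp only [egf, PowerSeries.coeff_mul, PowerSeries.coeff_mk,
    Finset.Nat.sum_antidiagonal_eq_sum_range_succ_mk, Finset.sum_div]
  refine Finset.sum_congr rfl fun i hi => ?_
  rw [Nat.cast_choose ℝ (Finset.mem_range_succ_iff.1 hi)]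
  have hn : (n.factorial : ℝ) ≠ 0 := by positivity
  field_simp

theorem egf_pow (x : ℝ) :
    egf (fun n => x ^ n) = PowerSeries.rescale x (PowerSeries.exp ℝ) := by
  ext n
  simp [egf, PowerSeries.coeff_exp, div_eq_mul_inv]

theorem coeff_egf_completeBell {k N : ℕ} (h : k ≤ N) (x : ℕ → ℝ) :
    (egf fun n => completeBell n x).coeff k = (bellProd N x).coeff k := by
  rw [coeff_bellProd_of_le h, coeff_bellProd_self, egf, PowerSeries.coeff_mk]

theorem egf_completeBell_add (x y : ℕ → ℝ) :
    egf (fun n => completeBell n fun i => x i + y i) =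
      egf (fun n => completeBell n x) * egf fun n => completeBell n y := by
  ext n
  rw [coeff_egf_completeBell le_rfl, bellProd_add, PowerSeries.coeff_mul, PowerSeries.coeff_mul]
  refine Finset.sum_congr rfl fun p hp => ?_
  rw [Finset.HasAntidiagonal.mem_antidiagonal] at hp
  rw [coeff_egf_completeBell (N := n) (by omega), coeff_egf_completeBell (N := n) (by omega)]

theorem egf_completeBell_single (x : ℝ) :
    egf (fun n => completeBell n fun i => if i = 1 then x else 0) = egf fun n => x ^ n := by
  ext n
  rw [coeff_egf_completeBell n.le_succ, egf_pow, bellProd, Finset.prod_range_succ']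
  simp [expMonomial_zero_right, expMonomial_zero_left]

theorem egf_completeBell_zero : egf (fun n => completeBell n fun _ => 0) = 1 := by
  ext n
  rw [coeff_egf_completeBell le_rfl]
  simp [bellProd, expMonomial_zero_right]

theorem completeBell_zero (x : ℕ → ℝ) : completeBell 0 x = 1 := by
  simpa [bellProd] using (coeff_bellProd_self 0 x).symm

/-- **Time-space harmonic polynomials via cumulants.** Given cumulants `(κ_n)`, let
`a_n = Y_n(tκ_1, …, tκ_n)` (the moments), `q` the inverse binomial convolution of `a`, and
`Q_k(x) = ∑_j C(k,j) q_j x^{k-j}`. Then `Q_k(x) = Y_k(x - tκ_1, -tκ_2, …, -tκ_k)` for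
`k ≥ 1`. -/
theorem tsh_eq_completeBell (κ : ℕ → ℝ) (t x : ℝ)
    (a : ℕ → ℝ) (ha0 : a 0 = 1)
    (ha : ∀ n : ℕ, 1 ≤ n → a n = completeBell n (fun i => t * κ i))
    (q : ℕ → ℝ) (hq0 : q 0 = 1)
    (hq : ∀ j : ℕ, 1 ≤ j →
      q j = -∑ i ∈ Finset.range j, (j.choose i : ℝ) * q i * a (j - i))
    (Q : ℕ → ℝ)
    (hQ : ∀ k : ℕ, Q k = ∑ j ∈ Finset.range (k + 1), (k.choose j : ℝ) * q j * x ^ (k - j)) :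
    ∀ k : ℕ, 1 ≤ k →
      Q k = completeBell k (fun i => if i = 1 then x - t * κ 1 else -t * κ i) := by

  have hA : egf a = egf fun n => completeBell n fun i => t * κ i := by
    congr 1
    funext n
    rcases Nat.eq_zero_or_pos n with rfl | hn
    · rw [ha0, completeBell_zero]
    · exact ha n hn
  have hqa : egf q * egf a = 1 := by
    rw [egf_mul]
    ext n
    rw [egf, PowerSeries.coeff_mk, PowerSeries.coeff_one]
    rcases Nat.eq_zero_or_pos n with rfl | hn
    · simp [hq0, ha0]
    · rw [Finset.sum_range_succ, hq n hn]
      simp [ha0, hn.ne']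
  have hAneg : egf a * egf (fun n => completeBell n fun i => -t * κ i) = 1 := by
    rw [hA, ← egf_completeBell_add, ← egf_completeBell_zero]
    simp
  have hqneg : egf q = egf fun n => completeBell n fun i => -t * κ i :=
    left_inv_eq_right_inv hqa hAneg
  have hQQ : egf Q =
      egf fun n => completeBell n fun i => if i = 1 then x - t * κ 1 else -t * κ i := by
    rw [funext hQ, ← egf_mul, hqneg, ← egf_completeBell_single, ← egf_completeBell_add]
    congr! 4 with n i
    split_ifs with h
    · rw [h]; ring
    · ring
  intro k _
  exact congrFun (egf_injective hQQ) k
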